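/- There exists R₀ > 2 such that for every R > R₀ and every measurable function t : (R₀, R) → (0, 1/ρ²) there is a constant C > 0, depending only on m_v, m_z, R₀ and R (but not on t), such that for every even Schwartz function φ : ℝ → ℂ vanishing on (−1/R₀, 1/R₀), one has ( ∫_{R₀}^{R} A(s)^{−1} | ∫_{1/R₀}^{∞} c(λ) exp(i[λ s + t(s)(λ²+ρ²)]) φ(λ) |c(λ)|^{−2} dλ |⁴ ds )^{1/4} ≤ C ( ∫_{1/R₀}^{∞} (λ²+ρ²)^{1/4} |φ(λ)|² |c(λ)|^{−2} dλ )^{1/2}. -/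

import Mathlib

open MeasureTheory Filter Set

noncomputable section

/-- The half-sum of roots `ρ = Q/2 = (m_v/2 + m_z)/2`. -/
def rhoDR (mv mz : ℕ) : ℝ := ((mv : ℝ) / 2 + mz) / 2

/-- The radial volume density of the Damek–Ricci space. -/
def Adens (mv mz : ℕ) (s : ℝ) : ℝ :=
  2 ^ (mv + mz) * Real.sinh (s / 2) ^ (mv + mz) * Real.cosh (s / 2) ^ mz

/-- The Harish-Chandra `c`-function of the Damek–Ricci space:
`c(λ) = 4^{ρ-iλ} (Γ(2iλ)/Γ(ρ+iλ)) (Γ(n/2)/Γ((m_v+4iλ+2)/4))`. -/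
def cHC (mv mz : ℕ) (l : ℝ) : ℂ :=
  (4 : ℂ) ^ ((rhoDR mv mz : ℂ) - Complex.I * l)
    * (Complex.Gamma (2 * Complex.I * l)
        / Complex.Gamma ((rhoDR mv mz : ℂ) + Complex.I * l))
    * (Complex.Gamma (((mv : ℂ) + mz + 1) / 2)
        / Complex.Gamma (((mv : ℂ) + 4 * Complex.I * l + 2) / 4))

end

lemma vdc (ψ dψ ddψ : ℝ → ℝ) (h1 : ∀ v, HasDerivAt ψ (dψ v) v)
    (h2 : ∀ v, HasDerivAt dψ (ddψ v) v) (hc : Continuous ddψ) (a b : ℝ) (hab : a ≤ b)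
    (hm : ∀ v ∈ Icc a b, 1 ≤ |dψ v|)
    (hs : (∀ v ∈ Icc a b, 0 ≤ ddψ v) ∨ (∀ v ∈ Icc a b, ddψ v ≤ 0)) :
    ‖∫ v in a..b, Complex.exp (Complex.I * (ψ v : ℂ))‖ ≤ 4 := by
  have hψ : Continuous ψ := continuous_iff_continuousAt.2 fun v => (h1 v).continuousAt
  have hdψ : Continuous dψ := continuous_iff_continuousAt.2 fun v => (h2 v).continuousAt
  have hne : ∀ v ∈ Icc a b, dψ v ≠ 0 := fun v hv h0 => by
    have := hm v hv; rw [h0] at this; norm_num at this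
  have hu : uIcc a b = Icc a b := uIcc_of_le hab
  have hinv : ∀ v ∈ Icc a b, |(dψ v)⁻¹| ≤ 1 := fun v hv => by
    rw [abs_inv]; exact inv_le_one_of_one_le₀ (hm v hv)
  -- the real part
  have hr : ∀ v ∈ uIcc a b, HasDerivAt (fun v => -(dψ v)⁻¹) (ddψ v / (dψ v)^2) v := by
    intro v hv
    rw [hu] at hv
    have := ((h2 v).inv (hne v hv)).neg
    refine this.congr_deriv ?_
    ring
  have hcr : ContinuousOn (fun v => ddψ v / (dψ v)^2) (uIcc a b) := by
    rw [hu]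
    exact hc.continuousOn.div (hdψ.pow 2).continuousOn (fun v hv => pow_ne_zero _ (hne v hv))
  have hri := intervalIntegral.integral_eq_sub_of_hasDerivAt hr hcr.intervalIntegrable
  have hrb : ∫ v in a..b, |ddψ v / (dψ v)^2| ≤ 2 := by
    have ha := hinv a ⟨le_rfl, hab⟩
    have hb := hinv b ⟨hab, le_rfl⟩
    rw [abs_le] at ha hb
    rcases hs with hs | hs
    · have : ∫ v in a..b, |ddψ v / (dψ v)^2| = ∫ v in a..b, ddψ v / (dψ v)^2 := by
        apply intervalIntegral.integral_congr
        intro v hv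
        rw [hu] at hv
        exact abs_of_nonneg (div_nonneg (hs v hv) (sq_nonneg _))
      rw [this, hri]; linarith
    · have : ∫ v in a..b, |ddψ v / (dψ v)^2| = ∫ v in a..b, -(ddψ v / (dψ v)^2) := by
        apply intervalIntegral.integral_congr
        intro v hv
        rw [hu] at hv
        exact abs_of_nonpos (div_nonpos_of_nonpos_of_nonneg (hs v hv) (sq_nonneg _))
      rw [this, intervalIntegral.integral_neg, hri]; linarith
  -- complex part
  have hE : Continuous fun v => Complex.exp (Complex.I * (ψ v : ℂ)) := by fun_prop
  have hnE : ∀ v, ‖Complex.exp (Complex.I * (ψ v : ℂ))‖ = 1 := fun v => by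
    rw [mul_comm]; exact Complex.norm_exp_ofReal_mul_I _
  have hH : ∀ v ∈ uIcc a b, HasDerivAt
      (fun v => Complex.exp (Complex.I * (ψ v : ℂ)) * (-Complex.I * ((dψ v)⁻¹ : ℝ)))
      (Complex.exp (Complex.I * (ψ v : ℂ)) +
        Complex.exp (Complex.I * (ψ v : ℂ)) * (Complex.I * (ddψ v / (dψ v)^2 : ℝ))) v := by
    intro v hv
    have e1 : HasDerivAt (fun v => Complex.exp (Complex.I * (ψ v : ℂ)))
        (Complex.exp (Complex.I * (ψ v : ℂ)) * (Complex.I * (dψ v : ℂ))) v :=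
      ((h1 v).ofReal_comp.const_mul Complex.I).cexp
    have e2 := ((hr v hv).ofReal_comp.const_mul Complex.I)
    have e3 := e1.mul e2
    rw [hu] at hv
    have hn : (dψ v : ℂ) ≠ 0 := by exact_mod_cast hne v hv
    have hfun : (fun v => Complex.exp (Complex.I * (ψ v : ℂ)) * (-Complex.I * ((dψ v)⁻¹ : ℝ))) =
        (fun v => Complex.exp (Complex.I * (ψ v : ℂ))) *
          fun y => Complex.I * ((-(dψ y)⁻¹ : ℝ) : ℂ) := by
      funext w; simp
    rw [hfun]
    refine e3.congr_deriv ?_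
    push_cast
    have h5 : (dψ v : ℂ) * (dψ v : ℂ)⁻¹ = 1 := mul_inv_cancel₀ hn
    linear_combination (-Complex.exp (Complex.I * (ψ v : ℂ))) * (dψ v : ℂ) * (dψ v : ℂ)⁻¹ *
      Complex.I_sq + Complex.exp (Complex.I * (ψ v : ℂ)) * h5
  have hc2 : ContinuousOn (fun v => Complex.exp (Complex.I * (ψ v : ℂ)) *
      (Complex.I * (ddψ v / (dψ v)^2 : ℝ))) (uIcc a b) := by
    apply hE.continuousOn.mul (continuousOn_const.mul _)
    exact Complex.continuous_ofReal.comp_continuousOn hcr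
  have hi := intervalIntegral.integral_eq_sub_of_hasDerivAt hH
    (hE.continuousOn.add hc2).intervalIntegrable
  rw [intervalIntegral.integral_add hE.continuousOn.intervalIntegrable hc2.intervalIntegrable] at hi
  have hb2 : ‖∫ v in a..b, Complex.exp (Complex.I * (ψ v : ℂ)) *
      (Complex.I * (ddψ v / (dψ v)^2 : ℝ))‖ ≤ 2 := by
    refine (intervalIntegral.norm_integral_le_integral_norm hab).trans (le_trans (le_of_eq ?_) hrb)
    apply intervalIntegral.integral_congr
    intro v hv
    simp only [norm_mul, hnE, Complex.norm_I, Complex.norm_real, one_mul, Real.norm_eq_abs]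
  have hbd : ∀ v ∈ Icc a b,
      ‖Complex.exp (Complex.I * (ψ v : ℂ)) * (-Complex.I * ((dψ v)⁻¹ : ℝ))‖ ≤ 1 := by
    intro v hv
    rw [norm_mul, hnE, norm_mul, norm_neg, Complex.norm_I, Complex.norm_real, one_mul, one_mul]
    exact hinv v hv
  have hba := hbd a ⟨le_rfl, hab⟩
  have hbb := hbd b ⟨hab, le_rfl⟩
  rw [← eq_sub_iff_add_eq] at hi
  rw [hi]
  refine (norm_sub_le _ _).trans ?_
  have := norm_sub_le (Complex.exp (Complex.I * (ψ b : ℂ)) * (-Complex.I * ((dψ b)⁻¹ : ℝ)))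
    (Complex.exp (Complex.I * (ψ a : ℂ)) * (-Complex.I * ((dψ a)⁻¹ : ℝ)))
  linarith

/-- Uniform bounds for sub-intervals glue. -/
lemma glueB (f : ℝ → ℂ) (hf : Continuous f) (p q r B B2 : ℝ) (hB : 0 ≤ B) (hB2 : 0 ≤ B2)
    (h1 : ∀ a b, p ≤ a → a ≤ b → b ≤ q → ‖∫ v in a..b, f v‖ ≤ B)
    (h2 : ∀ a b, q ≤ a → a ≤ b → b ≤ r → ‖∫ v in a..b, f v‖ ≤ B2) :
    ∀ a b, p ≤ a → a ≤ b → b ≤ r → ‖∫ v in a..b, f v‖ ≤ B + B2 := by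
  intro a b ha hab hb
  rcases le_total b q with hq | hq
  · linarith [h1 a b ha hab hq]
  rcases le_total q a with hq2 | hq2
  · linarith [h2 a b hq2 hab hb]
  rw [← intervalIntegral.integral_add_adjacent_intervals (hf.intervalIntegrable a q)
    (hf.intervalIntegrable q b)]
  exact (norm_add_le _ _).trans (add_le_add (h1 a q ha hq2 le_rfl) (h2 q b le_rfl hq hb))

lemma trivB (ψ : ℝ → ℝ) (a b : ℝ) (hab : a ≤ b) :
    ‖∫ v in a..b, Complex.exp (Complex.I * (ψ v : ℂ))‖ ≤ b - a := by
  have := intervalIntegral.norm_integral_le_of_norm_le_const (a := a) (b := b) (C := 1)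
    (f := fun v => Complex.exp (Complex.I * (ψ v : ℂ))) (fun v _ => by
      rw [mul_comm]; exact (Complex.norm_exp_ofReal_mul_I _).le)
  rwa [one_mul, abs_of_nonneg (by linarith)] at this

lemma quartic_bound (τ a b : ℝ) (ha : 0 ≤ a) (hab : a ≤ b) :
    ‖∫ v in a..b, Complex.exp (Complex.I * ((v ^ 2 + τ * v ^ 4 : ℝ) : ℂ))‖ ≤ 15 := by
  have hf : Continuous fun v : ℝ => Complex.exp (Complex.I * ((v ^ 2 + τ * v ^ 4 : ℝ) : ℂ)) := by
    fun_prop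
  have d1 : ∀ v : ℝ, HasDerivAt (fun v : ℝ => v ^ 2 + τ * v ^ 4) (2 * v + 4 * τ * v ^ 3) v := by
    intro v
    have := (hasDerivAt_pow 2 v).add ((hasDerivAt_pow 4 v).const_mul τ)
    refine this.congr_deriv ?_
    norm_num; ring
  have d2 : ∀ v : ℝ, HasDerivAt (fun v : ℝ => 2 * v + 4 * τ * v ^ 3) (2 + 12 * τ * v ^ 2) v := by
    intro v
    have := ((hasDerivAt_id v).const_mul 2).add ((hasDerivAt_pow 3 v).const_mul (4 * τ))
    refine this.congr_deriv ?_
    norm_num; ring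
  have d3 : Continuous (fun v : ℝ => 2 + 12 * τ * v ^ 2) := by fun_prop
  have V := fun a b hab hm hs => vdc _ _ _ d1 d2 d3 a b hab hm hs
  have T : ∀ p q : ℝ, ∀ a b, p ≤ a → a ≤ b → b ≤ q →
      ‖∫ v in a..b, Complex.exp (Complex.I * ((v ^ 2 + τ * v ^ 4 : ℝ) : ℂ))‖ ≤ q - p := by
    intro p q a b h1 h2 h3
    have := trivB (fun v => v ^ 2 + τ * v ^ 4) a b h2
    linarith
  rcases le_or_gt 0 τ with hτ | hτ
  · have := glueB _ hf 0 1 b _ 4 (by norm_num) (by norm_num) (T 0 1) (by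
      intro a b h1 h2 h3
      refine V a b h2 (fun v hv => ?_) (Or.inl fun v hv => by positivity)
      have hv1 : 1 ≤ v := h1.trans hv.1
      have : 0 ≤ 4 * τ * v ^ 3 := by positivity
      exact le_trans (by linarith) (le_abs_self _)) a b ha hab le_rfl
    linarith
  · obtain ⟨w, hw0, hw⟩ : ∃ w : ℝ, 0 < w ∧ τ * (6 * w ^ 2) = -1 := by
      refine ⟨Real.sqrt (1 / (6 * (-τ))), Real.sqrt_pos.2 (by apply div_pos <;> linarith), ?_⟩
      rw [Real.sq_sqrt (by apply le_of_lt; apply div_pos <;> linarith)]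
      have : τ ≠ 0 := hτ.ne
      field_simp
    set z : ℝ := Real.sqrt 3 * w with hz
    have h3 : Real.sqrt 3 ^ 2 = 3 := Real.sq_sqrt (by norm_num)
    have hz2 : z ^ 2 = 3 * w ^ 2 := by rw [hz, mul_pow, h3]
    have hz0 : 0 < z := by positivity
    have hzw : z ≤ 2 * w := by nlinarith
    have hτz : τ * (2 * z ^ 2) = -1 := by rw [hz2]; linarith
    have hd : ∀ v, (2 * v + 4 * τ * v ^ 3) * z ^ 2 = 2 * v * (z - v) * (z + v) := by
      intro v; linear_combination 2 * v ^ 3 * hτz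
    have hdd : ∀ v, (2 + 12 * τ * v ^ 2) * w ^ 2 = 2 * (w - v) * (w + v) := by
      intro v; linear_combination 2 * v ^ 2 * hw
    have hpos : ∀ v, 0 < v → v ≤ w → 0 ≤ 2 + 12 * τ * v ^ 2 := by
      intro v h0 h1
      have : 0 ≤ (2 + 12 * τ * v ^ 2) * w ^ 2 := by
        rw [hdd]
        have : 0 ≤ w - v := by linarith
        positivity
      exact nonneg_of_mul_nonneg_left this (by positivity)
    have hneg : ∀ v, w ≤ v → 2 + 12 * τ * v ^ 2 ≤ 0 := by
      intro v h1
      have : 0 ≤ (-(2 + 12 * τ * v ^ 2)) * w ^ 2 := by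
        rw [neg_mul, hdd]
        nlinarith
      have := nonneg_of_mul_nonneg_left this (by positivity)
      linarith
    have G1 := glueB _ hf 0 1 w _ 4 (by norm_num) (by norm_num) (T 0 1) (by
      intro a b h1 h2 h3
      refine V a b h2 (fun v hv => ?_)
        (Or.inl fun v hv => hpos v (by linarith [hv.1]) (hv.2.trans h3))
      have hv1 : 1 ≤ v := h1.trans hv.1
      have hv2 : v ≤ w := hv.2.trans h3
      refine le_trans ?_ (le_abs_self _)
      have : 0 ≤ (2 * v + 4 * τ * v ^ 3 - 1) * z ^ 2 := by
        have : v ^ 2 ≤ w ^ 2 := by nlinarith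
        have e : (2 * v + 4 * τ * v ^ 3 - 1) * z ^ 2 = 2 * v * (z ^ 2 - v ^ 2) - z ^ 2 := by
          linear_combination hd v
        rw [e]
        nlinarith [mul_nonneg (by linarith : 0 ≤ v - 1) (by nlinarith : 0 ≤ z ^ 2 - v ^ 2)]
      have := nonneg_of_mul_nonneg_left this (by positivity)
      linarith)
    have G2 := glueB _ hf 0 w (z - 1) _ 4 (by norm_num) (by norm_num) G1 (by
      intro a b h1 h2 h3
      refine V a b h2 (fun v hv => ?_)
        (Or.inr fun v hv => hneg v (h1.trans hv.1))
      have hv1 : w ≤ v := h1.trans hv.1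
      have hv2 : v ≤ z - 1 := hv.2.trans h3
      refine le_trans ?_ (le_abs_self _)
      have : 0 ≤ (2 * v + 4 * τ * v ^ 3 - 1) * z ^ 2 := by
        have e : (2 * v + 4 * τ * v ^ 3 - 1) * z ^ 2 = 2 * v * (z - v) * (z + v) - z ^ 2 := by
          linear_combination hd v
        rw [e]
        have a1 : z ≤ 2 * v := by linarith
        have a2 : z ≤ z + v := by linarith
        have a3 : z * z ≤ (2 * v) * (z + v) := mul_le_mul a1 a2 hz0.le (by linarith)
        nlinarith [mul_nonneg (by linarith : 0 ≤ z - v - 1) (by nlinarith : 0 ≤ (2 * v) * (z + v))]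
      have := nonneg_of_mul_nonneg_left this (by positivity)
      linarith)
    have G3 := glueB _ hf 0 (z - 1) (z + 1) _ _ (by norm_num) (by norm_num) G2 (T (z - 1) (z + 1))
    have G4 := glueB _ hf 0 (z + 1) b _ 4 (by linarith) (by norm_num) G3 (by
      intro a b h1 h2 h3
      refine V a b h2 (fun v hv => ?_)
        (Or.inr fun v hv => hneg v (by nlinarith [hv.1]))
      have hv1 : z + 1 ≤ v := h1.trans hv.1
      refine le_trans ?_ (neg_le_abs _)
      have : 0 ≤ (-(2 * v + 4 * τ * v ^ 3) - 1) * z ^ 2 := by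
        have e : (-(2 * v + 4 * τ * v ^ 3) - 1) * z ^ 2 = 2 * v * (v - z) * (z + v) - z ^ 2 := by
          linear_combination - hd v
        rw [e]
        have a1 : z ≤ 2 * v := by linarith
        have a2 : z ≤ z + v := by linarith
        have a3 : z * z ≤ (2 * v) * (z + v) := mul_le_mul a1 a2 hz0.le (by linarith)
        nlinarith [mul_nonneg (by linarith : 0 ≤ v - z - 1) (by nlinarith : 0 ≤ (2 * v) * (z + v))]
      have := nonneg_of_mul_nonneg_left this (by positivity)
      linarith)
    have := G4 a b ha hab le_rfl
    linarith

lemma kernel_pos (x τ δ L : ℝ) (hx : 0 < x) (hδ : 0 < δ) (hL : δ ≤ L) :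
    ‖∫ l in δ..L, (((Real.sqrt l)⁻¹ : ℝ) : ℂ) *
      Complex.exp (Complex.I * ((l * x + τ * l ^ 2 : ℝ) : ℂ))‖ ≤ 30 * (Real.sqrt x)⁻¹ := by
  have hsx : 0 < Real.sqrt x := Real.sqrt_pos.2 hx
  have hx2 : Real.sqrt x ^ 2 = x := Real.sq_sqrt hx.le
  set a := Real.sqrt (δ * x) with ha
  set b := Real.sqrt (L * x) with hb
  have ha0 : 0 < a := Real.sqrt_pos.2 (by positivity)
  have hab : a ≤ b := Real.sqrt_le_sqrt (by nlinarith)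
  have hfa : a ^ 2 / x = δ := by
    rw [ha, Real.sq_sqrt (by positivity)]; field_simp
  have hfb : b ^ 2 / x = L := by
    rw [hb, Real.sq_sqrt (by nlinarith)]; field_simp
  have key := intervalIntegral.integral_deriv_smul_comp' (a := a) (b := b)
    (f := fun v : ℝ => v ^ 2 / x) (f' := fun v => 2 * v / x)
    (g := fun l : ℝ => (((Real.sqrt l)⁻¹ : ℝ) : ℂ) *
      Complex.exp (Complex.I * ((l * x + τ * l ^ 2 : ℝ) : ℂ)))
    (fun v _ => by
      refine ((hasDerivAt_pow 2 v).div_const x).congr_deriv ?_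
      norm_num)
    (by fun_prop)
    (by
      apply ContinuousOn.mul
      · apply Complex.continuous_ofReal.comp_continuousOn
        apply ContinuousOn.inv₀ (by fun_prop)
        rintro l ⟨v, hv, rfl⟩
        rw [uIcc_of_le hab] at hv
        have : 0 < v := ha0.trans_le hv.1
        exact (Real.sqrt_pos.2 (by positivity)).ne'
      · fun_prop)
  simp only [hfa, hfb] at key
  rw [← key]
  have : ∫ v in a..b, (2 * v / x) • ((fun l : ℝ => (((Real.sqrt l)⁻¹ : ℝ) : ℂ) *
      Complex.exp (Complex.I * ((l * x + τ * l ^ 2 : ℝ) : ℂ))) ∘ fun v : ℝ => v ^ 2 / x) v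
      = ∫ v in a..b, ((2 * (Real.sqrt x)⁻¹ : ℝ) : ℂ) *
        Complex.exp (Complex.I * ((v ^ 2 + (τ / x ^ 2) * v ^ 4 : ℝ) : ℂ)) := by
    apply intervalIntegral.integral_congr
    intro v hv
    rw [uIcc_of_le hab] at hv
    have hv0 : 0 < v := ha0.trans_le hv.1
    have e1 : v ^ 2 / x * x + τ * (v ^ 2 / x) ^ 2 = v ^ 2 + (τ / x ^ 2) * v ^ 4 := by
      field_simp
    have e2 : Real.sqrt (v ^ 2 / x) = v / Real.sqrt x := by
      rw [Real.sqrt_div (by positivity), Real.sqrt_sq hv0.le]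
    simp only [Function.comp, e1, e2]
    rw [Complex.real_smul, ← mul_assoc, ← Complex.ofReal_mul]
    congr 2
    field_simp
    exact hx2
  rw [this, intervalIntegral.integral_const_mul, norm_mul, Complex.norm_real, Real.norm_eq_abs,
    abs_of_pos (by positivity)]
  have := quartic_bound (τ / x ^ 2) a b ha0.le hab
  have h0 : 0 < (Real.sqrt x)⁻¹ := by positivity
  nlinarith

lemma kernel_bound (x τ δ L : ℝ) (hx : x ≠ 0) (hδ : 0 < δ) (hL : δ ≤ L) :
    ‖∫ l in δ..L, (((Real.sqrt l)⁻¹ : ℝ) : ℂ) *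
      Complex.exp (Complex.I * ((l * x + τ * l ^ 2 : ℝ) : ℂ))‖ ≤ 30 * (Real.sqrt |x|)⁻¹ := by
  rcases lt_or_gt_of_ne hx with h | h
  · rw [abs_of_neg h]
    have := kernel_pos (-x) (-τ) δ L (by linarith) hδ hL
    refine le_trans (le_of_eq ?_) this
    rw [← RCLike.norm_conj, intervalIntegral.integral_of_le hL, ← integral_conj,
      intervalIntegral.integral_of_le hL]
    congr 2
    funext l
    rw [map_mul, ← Complex.exp_conj, map_mul, Complex.conj_I, Complex.conj_ofReal,
      Complex.conj_ofReal]
    congr 2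
    push_cast
    ring
  · rw [abs_of_pos h]
    exact kernel_pos x τ δ L h hδ hL

lemma lint_abs (f : ℝ → ENNReal) (x : ℝ) :
    ∫⁻ y, f |x - y| = 2 * ∫⁻ z in Ioi 0, f z := by
  rw [lintegral_sub_left_eq_self (fun z => f |z|) x,
    ← lintegral_add_compl (fun z => f |z|) (measurableSet_Ioi (a := (0:ℝ))), compl_Ioi, two_mul]
  congr 1
  · exact setLIntegral_congr_fun measurableSet_Ioi fun z hz => by rw [abs_of_pos hz]
  · rw [setLIntegral_congr Iio_ae_eq_Iic.symm, ← lintegral_indicator measurableSet_Iio,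
      ← lintegral_neg_eq_self, ← lintegral_indicator measurableSet_Ioi]
    congr 1
    funext z
    by_cases hz : 0 < z
    · simp [indicator, hz, abs_of_pos hz]
    · simp [indicator, hz]

lemma lint_inv_sqrt (r : ℝ) (hr : 0 < r) :
    ∫⁻ z in Ioc 0 r, ENNReal.ofReal ((Real.sqrt z)⁻¹) = ENNReal.ofReal (2 * Real.sqrt r) := by
  have e : ∀ z ∈ Ioc 0 r, (Real.sqrt z)⁻¹ = z ^ (-(1/2) : ℝ) := fun z hz => by
    rw [Real.sqrt_eq_rpow, Real.rpow_neg hz.1.le]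
  rw [setLIntegral_congr_fun measurableSet_Ioc (fun z hz => by rw [e z hz]),
    ← ofReal_integral_eq_lintegral_ofReal]
  · rw [← intervalIntegral.integral_of_le hr.le, integral_rpow (Or.inl (by norm_num)),
      Real.sqrt_eq_rpow]
    congr 1
    rw [show (-(1/2) + 1 : ℝ) = 1/2 by norm_num, Real.zero_rpow (by norm_num)]
    ring
  · exact (intervalIntegrable_iff_integrableOn_Ioc_of_le hr.le).1
      (intervalIntegral.intervalIntegrable_rpow' (by norm_num))
  · exact (ae_restrict_mem measurableSet_Ioc).mono fun z hz => Real.rpow_nonneg hz.1.le _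

lemma lint_inv_sq (r : ℝ) (hr : 0 < r) :
    ∫⁻ z in Ioi r, ENNReal.ofReal ((z ^ 2)⁻¹) = ENNReal.ofReal (r⁻¹) := by
  have e : ∀ z ∈ Ioi r, (z ^ 2)⁻¹ = z ^ (-2 : ℝ) := fun z hz => by
    have : 0 < z := hr.trans hz
    rw [Real.rpow_neg this.le]; norm_cast
  rw [setLIntegral_congr_fun measurableSet_Ioi (fun z hz => by rw [e z hz]),
    ← ofReal_integral_eq_lintegral_ofReal]
  · rw [integral_Ioi_rpow_of_lt (by norm_num) hr]
    norm_num
    rw [Real.rpow_neg_one]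
  · exact integrableOn_Ioi_rpow_of_lt (by norm_num) hr
  · exact (ae_restrict_mem measurableSet_Ioi).mono fun z hz => Real.rpow_nonneg (hr.trans hz).le _

lemma hls_inner (u : ℝ → ℝ) (hu : Measurable u) (hu0 : ∀ x, 0 ≤ u x) (S : Set ℝ)
    (M : ℝ) (hM0 : 0 < M)
    (hM : ∫⁻ y in S, ENNReal.ofReal (u y ^ 4) ≤ ENNReal.ofReal M) (x : ℝ) (hx : 0 < u x) :
    ∫⁻ y in S, {y | u y ≤ u x}.indicator
      (fun y => ENNReal.ofReal (u y ^ 3 * (Real.sqrt |x - y|)⁻¹)) y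
      ≤ ENNReal.ofReal (7 * u x * Real.sqrt M) := by
  set a := u x with ha
  set m := Real.sqrt M with hm
  have hm0 : 0 < m := Real.sqrt_pos.2 hM0
  have hm2 : m ^ 2 = M := Real.sq_sqrt hM0.le
  set r := (m / a ^ 2) ^ 2 with hr
  have hr0 : 0 < r := by positivity
  set ε := a / m with hε
  have hε0 : 0 < ε := by positivity
  let W : ℝ → ENNReal := fun z => if z ≤ r then ENNReal.ofReal (a ^ 3 * (Real.sqrt z)⁻¹)
    else ENNReal.ofReal ((ε ^ 3)⁻¹ * (z ^ 2)⁻¹)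
  have hWm : Measurable W := by
    apply Measurable.ite measurableSet_Iic <;> fun_prop
  have hW : ∫⁻ z in Ioi 0, W z = ENNReal.ofReal (3 * a * m) := by
    rw [← Ioc_union_Ioi_eq_Ioi hr0.le, lintegral_union measurableSet_Ioi Ioc_disjoint_Ioi_same]
    rw [setLIntegral_congr_fun (g := fun z => ENNReal.ofReal (a ^ 3) *
        ENNReal.ofReal ((Real.sqrt z)⁻¹)) measurableSet_Ioc (fun z hz => by
          simp only [W, if_pos hz.2]
          rw [ENNReal.ofReal_mul (by positivity)]),
      setLIntegral_congr_fun (g := fun z => ENNReal.ofReal ((ε ^ 3)⁻¹) *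
        ENNReal.ofReal ((z ^ 2)⁻¹)) measurableSet_Ioi (fun z hz => by
          simp only [W, if_neg (not_le.2 (mem_Ioi.1 hz))]
          rw [ENNReal.ofReal_mul (by positivity)]),
      lintegral_const_mul _ (by fun_prop), lintegral_const_mul _ (by fun_prop),
      lint_inv_sqrt r hr0, lint_inv_sq r hr0, ← ENNReal.ofReal_mul (by positivity),
      ← ENNReal.ofReal_mul (by positivity), ← ENNReal.ofReal_add (by positivity) (by positivity)]
    congr 1
    rw [hr, Real.sqrt_sq (by positivity), hε]
    field_simp
    ring
  have hpt : ∀ y, {y | u y ≤ a}.indicator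
      (fun y => ENNReal.ofReal (u y ^ 3 * (Real.sqrt |x - y|)⁻¹)) y ≤
      ENNReal.ofReal ε * ENNReal.ofReal (u y ^ 4) + W |x - y| := by
    intro y
    by_cases hy : u y ≤ a
    · rw [indicator_of_mem (by exact hy)]
      have h0 := hu0 y
      by_cases hz : |x - y| ≤ r
      · refine le_trans ?_ le_add_self
        simp only [W, if_pos hz]
        apply ENNReal.ofReal_le_ofReal
        gcongr
      · simp only [W, if_neg hz]
        rw [← ENNReal.ofReal_mul hε0.le, ← ENNReal.ofReal_add (by positivity) (by positivity)]
        apply ENNReal.ofReal_le_ofReal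
        have hz0 : 0 < |x - y| := hr0.trans (not_le.1 hz)
        set k := (Real.sqrt |x - y|)⁻¹ with hk
        have hk0 : 0 < k := inv_pos.2 (Real.sqrt_pos.2 hz0)
        have hk4 : (|x - y| ^ 2)⁻¹ = k ^ 4 := by
          rw [hk, inv_pow]
          congr 1
          rw [show (4:ℕ) = 2 * 2 from rfl, pow_mul, Real.sq_sqrt hz0.le]
        rw [hk4]
        rcases le_total k (ε * u y) with h | h
        · have : u y ^ 3 * k ≤ u y ^ 3 * (ε * u y) := by gcongr
          have h2 : 0 ≤ (ε ^ 3)⁻¹ * k ^ 4 := by positivity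
          nlinarith
        · have h1 : (ε * u y) ^ 3 ≤ k ^ 3 := by gcongr
          have h2 : u y ^ 3 ≤ (ε ^ 3)⁻¹ * k ^ 3 := by
            rw [inv_mul_eq_div, le_div_iff₀ (by positivity)]
            linarith [mul_pow ε (u y) 3]
          have h3 : u y ^ 3 * k ≤ (ε ^ 3)⁻¹ * k ^ 3 * k := by gcongr
          have h4 : 0 ≤ ε * u y ^ 4 := by positivity
          nlinarith
    · rw [indicator_of_notMem (by exact hy)]
      exact zero_le
  calc _ ≤ ∫⁻ y in S, (ENNReal.ofReal ε * ENNReal.ofReal (u y ^ 4) + W |x - y|) :=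
        lintegral_mono hpt
    _ = (∫⁻ y in S, ENNReal.ofReal ε * ENNReal.ofReal (u y ^ 4)) + ∫⁻ y in S, W |x - y| :=
        lintegral_add_left (by fun_prop) _
    _ ≤ ENNReal.ofReal ε * ENNReal.ofReal M + ∫⁻ y, W |x - y| := by
        rw [lintegral_const_mul _ (by fun_prop)]
        gcongr
        exact Measure.restrict_le_self
    _ = ENNReal.ofReal (7 * a * m) := by
        rw [lint_abs, hW, ← ENNReal.ofReal_mul hε0.le,
          show (2 : ENNReal) = ENNReal.ofReal 2 by simp,
          ← ENNReal.ofReal_mul (by norm_num),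
          ← ENNReal.ofReal_add (by positivity) (by positivity)]
        congr 1
        rw [← hm2, hε]
        field_simp
        ring

lemma hls (u : ℝ → ℝ) (hu : Measurable u) (hu0 : ∀ x, 0 ≤ u x) (S : Set ℝ)
    (M : ℝ) (hM0 : 0 < M)
    (hM : ∫⁻ y in S, ENNReal.ofReal (u y ^ 4) ≤ ENNReal.ofReal M) :
    ∫⁻ x in S, ∫⁻ y in S, ENNReal.ofReal (u x ^ 3 * u y ^ 3 * (Real.sqrt |x - y|)⁻¹)
      ≤ ENNReal.ofReal (14 * M * Real.sqrt M) := by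
  let P : ℝ → ℝ → ENNReal := fun x y => if u y ≤ u x then
    ENNReal.ofReal (u x ^ 3 * u y ^ 3 * (Real.sqrt |x - y|)⁻¹) else 0
  have hP : Measurable (Function.uncurry P) := by
    apply Measurable.ite
    · exact measurableSet_le (hu.comp measurable_snd) (hu.comp measurable_fst)
    · have h1 : Measurable fun p : ℝ × ℝ => u p.1 := hu.comp measurable_fst
      have h2 : Measurable fun p : ℝ × ℝ => u p.2 := hu.comp measurable_snd
      fun_prop
    · fun_prop
  have h1 : ∫⁻ x in S, ∫⁻ y in S, P x y ≤ ENNReal.ofReal (7 * M * Real.sqrt M) := by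
    have : ∀ x, ∫⁻ y in S, P x y ≤
        ENNReal.ofReal (7 * Real.sqrt M) * ENNReal.ofReal (u x ^ 4) := by
      intro x
      rcases (hu0 x).eq_or_lt with h | h
      · have : ∀ y, P x y = 0 := fun y => by simp [P, ← h]
        simp [this]
      · have e : ∀ y, P x y = ENNReal.ofReal (u x ^ 3) * {y | u y ≤ u x}.indicator
            (fun y => ENNReal.ofReal (u y ^ 3 * (Real.sqrt |x - y|)⁻¹)) y := by
          intro y
          by_cases hy : u y ≤ u x
          · rw [indicator_of_mem (by exact hy), ← ENNReal.ofReal_mul (by positivity)]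
            simp only [P, if_pos hy, mul_assoc]
          · rw [indicator_of_notMem (by exact hy)]
            simp only [P, if_neg hy, mul_zero]
        simp_rw [e]
        rw [lintegral_const_mul' _ _ ENNReal.ofReal_ne_top]
        refine (mul_le_mul_right (hls_inner u hu hu0 S M hM0 hM x h) _).trans (le_of_eq ?_)
        rw [← ENNReal.ofReal_mul (by positivity), ← ENNReal.ofReal_mul (by positivity)]
        congr 1
        ring
    refine (lintegral_mono this).trans ?_
    rw [lintegral_const_mul _ (by fun_prop)]
    refine (mul_le_mul_right hM _).trans (le_of_eq ?_)
    rw [← ENNReal.ofReal_mul (by positivity)]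
    congr 1
    ring
  have h2 : ∫⁻ x in S, ∫⁻ y in S, P y x = ∫⁻ x in S, ∫⁻ y in S, P x y :=
    lintegral_lintegral_swap (f := fun x y => P y x) (hP.comp measurable_swap).aemeasurable
  have h3 : ∀ x y, ENNReal.ofReal (u x ^ 3 * u y ^ 3 * (Real.sqrt |x - y|)⁻¹) ≤ P x y + P y x := by
    intro x y
    rcases le_total (u y) (u x) with h | h
    · refine le_trans (le_of_eq ?_) le_self_add
      simp only [P, if_pos h]
    · refine le_trans (le_of_eq ?_) le_add_self
      simp only [P, if_pos h]
      rw [abs_sub_comm, mul_comm (u x ^ 3)]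
  calc _ ≤ ∫⁻ x in S, ∫⁻ y in S, (P x y + P y x) :=
        lintegral_mono fun x => lintegral_mono fun y => h3 x y
    _ = ∫⁻ x in S, ((∫⁻ y in S, P x y) + ∫⁻ y in S, P y x) := by
        congr 1; funext x
        exact lintegral_add_left (hP.comp measurable_prodMk_left) _
    _ = (∫⁻ x in S, ∫⁻ y in S, P x y) + ∫⁻ x in S, ∫⁻ y in S, P y x := by
        exact lintegral_add_left hP.lintegral_prod_right' _
    _ ≤ ENNReal.ofReal (7 * M * Real.sqrt M) + ENNReal.ofReal (7 * M * Real.sqrt M) := by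
        rw [h2]; gcongr
    _ = _ := by
        rw [← ENNReal.ofReal_add (by positivity) (by positivity)]
        congr 1; ring

/-- The oscillating factor. -/
noncomputable def Eph (t : ℝ → ℝ) (s l : ℝ) : ℂ :=
  Complex.exp (Complex.I * ((l * s + t s * l ^ 2 : ℝ) : ℂ))

lemma Eph_norm (t : ℝ → ℝ) (s l : ℝ) : ‖Eph t s l‖ = 1 := by
  rw [Eph, mul_comm]; exact Complex.norm_exp_ofReal_mul_I _

lemma Eph_meas (t : ℝ → ℝ) (ht : Measurable t) :
    Measurable fun p : ℝ × ℝ => Eph t p.1 p.2 := by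
  have : Measurable fun p : ℝ × ℝ => t p.1 := ht.comp measurable_fst
  unfold Eph
  fun_prop

lemma Eph_mul_conj (t : ℝ → ℝ) (s s2 l : ℝ) :
    Eph t s l * (starRingEnd ℂ) (Eph t s2 l) =
      Complex.exp (Complex.I * ((l * (s - s2) + (t s - t s2) * l ^ 2 : ℝ) : ℂ)) := by
  rw [Eph, Eph, ← Complex.exp_conj, map_mul, Complex.conj_I, Complex.conj_ofReal, ← Complex.exp_add]
  congr 1
  push_cast
  ring

/-- The quadratic form estimate (kernel bound + Hardy-Littlewood-Sobolev). -/
lemma quad_bound (δ L R₀ R : ℝ) (hδ : 0 < δ) (hL : δ ≤ L) (t : ℝ → ℝ) (ht : Measurable t)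
    (h : ℝ → ℂ) (hh : Measurable h) (u : ℝ → ℝ) (hu : Measurable u) (hu0 : ∀ x, 0 ≤ u x)
    (hhu : ∀ s, ‖h s‖ = u s ^ 3) (B : ℝ) (hB : ∀ s, ‖h s‖ ≤ B) (M : ℝ) (hM0 : 0 < M)
    (hM : ∫⁻ y in Ioo R₀ R, ENNReal.ofReal (u y ^ 4) ≤ ENNReal.ofReal M) :
    ∫ l in Ioc δ L, (Real.sqrt l)⁻¹ * ‖∫ s in Ioo R₀ R, h s * Eph t s l‖ ^ 2
      ≤ 420 * M * Real.sqrt M := by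
  set ν := volume.restrict (Ioo R₀ R) with hν
  set κ := volume.restrict (Ioc δ L) with hκ
  have hE := Eph_meas t ht
  set Φ : ℝ → ℝ × ℝ → ℂ := fun l p => (((Real.sqrt l)⁻¹ : ℝ) : ℂ) *
    ((h p.1 * Eph t p.1 l) * (starRingEnd ℂ) (h p.2 * Eph t p.2 l)) with hΦ
  have hC : Measurable (starRingEnd ℂ) := Complex.continuous_conj.measurable
  have hΦm2 : Measurable fun q : ℝ × ℝ × ℝ => ((h q.2.1 * Eph t q.2.1 q.1) *
      (starRingEnd ℂ) (h q.2.2 * Eph t q.2.2 q.1)) := by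
    have a1 : Measurable fun q : ℝ × ℝ × ℝ => h q.2.1 := hh.comp (by fun_prop)
    have a2 : Measurable fun q : ℝ × ℝ × ℝ => h q.2.2 := hh.comp (by fun_prop)
    have a3 : Measurable fun q : ℝ × ℝ × ℝ => Eph t q.2.1 q.1 :=
      hE.comp (by fun_prop : Measurable fun q : ℝ × ℝ × ℝ => (q.2.1, q.1))
    have a4 : Measurable fun q : ℝ × ℝ × ℝ => Eph t q.2.2 q.1 :=
      hE.comp (by fun_prop : Measurable fun q : ℝ × ℝ × ℝ => (q.2.2, q.1))
    exact (a1.mul a3).mul (hC.comp (a2.mul a4))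
  have hΦm : Measurable (Function.uncurry Φ) := by
    have : Measurable fun q : ℝ × ℝ × ℝ => (((Real.sqrt q.1)⁻¹ : ℝ) : ℂ) := by fun_prop
    exact this.mul hΦm2
  have hw : Integrable (fun l => (((Real.sqrt l)⁻¹ : ℝ) : ℂ)) κ := by
    apply Integrable.ofReal
    have : ContinuousOn (fun l => (Real.sqrt l)⁻¹) (Icc δ L) := by
      apply ContinuousOn.inv₀ (by fun_prop)
      intro l hl
      exact (Real.sqrt_pos.2 (hδ.trans_le hl.1)).ne'
    exact this.integrableOn_Icc.mono_set Ioc_subset_Icc_self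
  have hΦi : Integrable (Function.uncurry Φ) (κ.prod (ν.prod ν)) := by
    refine (hw.comp_fst (ν.prod ν)).mul_bdd (c := B * B) hΦm2.aestronglyMeasurable
      (Eventually.of_forall fun q => ?_)
    rw [norm_mul, RCLike.norm_conj, norm_mul, norm_mul, Eph_norm, Eph_norm, mul_one, mul_one]
    exact mul_le_mul (hB _) (hB _) (norm_nonneg _) ((norm_nonneg _).trans (hB q.2.1))
  have e1 : ((∫ l in Ioc δ L, (Real.sqrt l)⁻¹ * ‖∫ s in Ioo R₀ R, h s * Eph t s l‖ ^ 2 : ℝ) : ℂ)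
      = ∫ p, ∫ l, Φ l p ∂κ ∂(ν.prod ν) := by
    rw [← integral_integral_swap hΦi, ← integral_complex_ofReal]
    congr 1
    funext l
    rw [integral_const_mul, integral_prod_mul (fun s => h s * Eph t s l)
      (fun s => (starRingEnd ℂ) (h s * Eph t s l)), integral_conj, Complex.mul_conj,
      Complex.normSq_eq_norm_sq]
    push_cast
    rfl
  have e2 : ∀ s s2, s2 ≠ s → ‖∫ l, Φ l (s, s2) ∂κ‖ₑ ≤
      30 * ENNReal.ofReal (u s ^ 3 * u s2 ^ 3 * (Real.sqrt |s - s2|)⁻¹) := by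
    intro s s2 hne
    have : ∫ l, Φ l (s, s2) ∂κ = (h s * (starRingEnd ℂ) (h s2)) * ∫ l in δ..L,
        (((Real.sqrt l)⁻¹ : ℝ) : ℂ) *
        Complex.exp (Complex.I * ((l * (s - s2) + (t s - t s2) * l ^ 2 : ℝ) : ℂ)) := by
      rw [intervalIntegral.integral_of_le hL, ← integral_const_mul]
      congr 1
      funext l
      rw [← Eph_mul_conj]
      simp only [hΦ, map_mul]
      ring
    have hk := kernel_bound (s - s2) (t s - t s2) δ L (sub_ne_zero.2 hne.symm) hδ hL
    have h0 := hu0 s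
    have h02 := hu0 s2
    rw [this, ← ofReal_norm, show (30 : ENNReal) = ENNReal.ofReal 30 by simp,
      ← ENNReal.ofReal_mul (by norm_num)]
    apply ENNReal.ofReal_le_ofReal
    rw [norm_mul, norm_mul, RCLike.norm_conj, hhu, hhu]
    calc _ ≤ u s ^ 3 * u s2 ^ 3 * (30 * (Real.sqrt |s - s2|)⁻¹) := by gcongr
      _ = _ := by ring
  have hΨ : Measurable fun p => ∫ l, Φ l p ∂κ :=
    (hΦm.stronglyMeasurable.integral_prod_left (μ := κ)).measurable
  have e3 : ‖∫ p, ∫ l, Φ l p ∂κ ∂(ν.prod ν)‖ₑ ≤ ENNReal.ofReal (420 * M * Real.sqrt M) := by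
    refine (enorm_integral_le_lintegral_enorm _).trans ?_
    rw [lintegral_prod _ hΨ.enorm.aemeasurable]
    calc _ ≤ ∫⁻ s in Ioo R₀ R, ∫⁻ s2 in Ioo R₀ R,
          30 * ENNReal.ofReal (u s ^ 3 * u s2 ^ 3 * (Real.sqrt |s - s2|)⁻¹) := by
          refine lintegral_mono fun s => lintegral_mono_ae ?_
          filter_upwards [ν.ae_ne s] with s2 hs2
          exact e2 s s2 hs2
      _ = 30 * ∫⁻ s in Ioo R₀ R, ∫⁻ s2 in Ioo R₀ R,
          ENNReal.ofReal (u s ^ 3 * u s2 ^ 3 * (Real.sqrt |s - s2|)⁻¹) := by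
          rw [← lintegral_const_mul' _ _ (by norm_num)]
          congr 1; funext s
          rw [← lintegral_const_mul' _ _ (by norm_num)]
      _ ≤ 30 * ENNReal.ofReal (14 * M * Real.sqrt M) := by
          gcongr
          exact hls u hu hu0 _ M hM0 hM
      _ = _ := by
          rw [show (30 : ENNReal) = ENNReal.ofReal 30 by simp, ← ENNReal.ofReal_mul (by norm_num)]
          congr 1; ring
  rw [← e1, ← ofReal_norm, Complex.norm_real,
    ENNReal.ofReal_le_ofReal_iff (by positivity)] at e3
  exact (le_abs_self _).trans e3

lemma abstract_L4 (δ R₀ R : ℝ) (hδ : 0 < δ) (t : ℝ → ℝ) (ht : Measurable t)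
    (g : ℝ → ℂ) (hgm : Measurable g) (hg : IntegrableOn g (Ioi δ))
    (hG : IntegrableOn (fun l => Real.sqrt l * ‖g l‖ ^ 2) (Ioi δ)) :
    IntegrableOn (fun s => ‖∫ l in Ioi δ, Eph t s l * g l‖ ^ 4) (Ioo R₀ R) ∧
    ∫ s in Ioo R₀ R, ‖∫ l in Ioi δ, Eph t s l * g l‖ ^ 4 ≤
      (420 * ∫ l in Ioi δ, Real.sqrt l * ‖g l‖ ^ 2) ^ 2 := by
  set ν := volume.restrict (Ioo R₀ R) with hν
  set μ := volume.restrict (Ioi δ) with hμ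
  set F : ℝ → ℂ := fun s => ∫ l in Ioi δ, Eph t s l * g l with hF
  set G := ∫ l in Ioi δ, Real.sqrt l * ‖g l‖ ^ 2 with hGdef
  set M := ∫ s in Ioo R₀ R, ‖F s‖ ^ 4 with hMdef
  have hG0 : 0 ≤ G := integral_nonneg fun l => by positivity
  have hE := Eph_meas t ht
  have hEg : Measurable fun p : ℝ × ℝ => Eph t p.1 p.2 * g p.2 :=
    hE.mul (hgm.comp measurable_snd)
  have hFm : Measurable F := hEg.stronglyMeasurable.integral_prod_right'.measurable
  set b := ∫ l in Ioi δ, ‖g l‖ with hb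
  have hFb : ∀ s, ‖F s‖ ≤ b := fun s => by
    refine (norm_integral_le_integral_norm _).trans (le_of_eq ?_)
    congr 1; funext l
    rw [norm_mul, Eph_norm, one_mul]
  have hM0 : 0 ≤ M := integral_nonneg fun s => by positivity
  have hF4 : Integrable (fun s => ‖F s‖ ^ 4) ν := by
    refine Integrable.of_bound (hFm.norm.pow_const 4).aestronglyMeasurable (b ^ 4)
      (Eventually.of_forall fun s => ?_)
    rw [norm_pow, norm_norm]
    exact pow_le_pow_left₀ (norm_nonneg _) (hFb s) 4
  refine ⟨hF4, ?_⟩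
  rcases hM0.eq_or_lt with h0 | hMpos
  · rw [← h0]; positivity
  set h : ℝ → ℂ := fun s => (starRingEnd ℂ) (F s) * ((‖F s‖ ^ 2 : ℝ) : ℂ) with hh
  have hhm : Measurable h :=
    (Complex.continuous_conj.measurable.comp hFm).mul
      (Complex.measurable_ofReal.comp (hFm.norm.pow_const 2))
  have hhu : ∀ s, ‖h s‖ = ‖F s‖ ^ 3 := fun s => by
    rw [hh, norm_mul, RCLike.norm_conj, Complex.norm_real, norm_pow, norm_norm]; ring
  have hhb : ∀ s, ‖h s‖ ≤ b ^ 3 := fun s => by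
    rw [hhu]; exact pow_le_pow_left₀ (norm_nonneg _) (hFb s) 3
  have hMl : ∫⁻ y in Ioo R₀ R, ENNReal.ofReal (‖F y‖ ^ 4) ≤ ENNReal.ofReal M := by
    rw [hMdef, ofReal_integral_eq_lintegral_ofReal hF4
      (Eventually.of_forall fun s => by positivity)]
  set H : ℝ → ℂ := fun l => ∫ s in Ioo R₀ R, h s * Eph t s l with hH
  have hHE : Measurable fun p : ℝ × ℝ => h p.1 * Eph t p.1 p.2 := (hhm.comp measurable_fst).mul hE
  have hHm : Measurable H :=
    (StronglyMeasurable.integral_prod_left' (μ := ν) hHE.stronglyMeasurable).measurable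
  have hint : Integrable (Function.uncurry fun s l => (h s * Eph t s l) * g l) (ν.prod μ) := by
    refine (Integrable.comp_snd (μ := ν) hg).bdd_mul (c := b ^ 3) hHE.aestronglyMeasurable
      (Eventually.of_forall fun p => ?_)
    rw [norm_mul, Eph_norm, mul_one]; exact hhb _
  have hMc : (M : ℂ) = ∫ l in Ioi δ, H l * g l := by
    have a1 : (M : ℂ) = ∫ s, ∫ l, (h s * Eph t s l) * g l ∂μ ∂ν := by
      rw [hMdef, ← integral_complex_ofReal]
      congr 1; funext s
      simp_rw [mul_assoc]
      rw [integral_const_mul]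
      change _ = h s * F s
      have : F s * (starRingEnd ℂ) (F s) = ((‖F s‖ ^ 2 : ℝ) : ℂ) := by
        rw [Complex.mul_conj, Complex.normSq_eq_norm_sq]
      have e : h s * F s = ((‖F s‖ ^ 2 : ℝ) : ℂ) * ((‖F s‖ ^ 2 : ℝ) : ℂ) := by
        rw [← this]
        simp only [hh]
        rw [← this]
        ring
      rw [e, ← Complex.ofReal_mul]
      congr 1; ring
    rw [a1, integral_integral_swap hint]
    congr 1; funext l
    rw [integral_mul_const]
  have hHg : IntegrableOn (fun l => H l * g l) (Ioi δ) := by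
    have := hint.integral_prod_right
    refine this.congr (Eventually.of_forall fun l => ?_)
    simp only [Function.uncurry]
    rw [integral_mul_const]
  have hm0 : 0 < Real.sqrt M := Real.sqrt_pos.2 hMpos
  have hm2 : Real.sqrt M * Real.sqrt M = M := Real.mul_self_sqrt hM0
  have hHb : ∀ l, ‖H l‖ ≤ ∫ s in Ioo R₀ R, b ^ 3 := fun l => by
    refine norm_integral_le_of_norm_le (integrable_const _) (Eventually.of_forall fun s => ?_)
    rw [norm_mul, Eph_norm, mul_one]; exact hhb _
  have hLb : ∀ L, δ ≤ L → ‖∫ l in δ..L, H l * g l‖ ≤ 210 * Real.sqrt M * G + M / 2 := by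
    intro L hL
    have hQ := quad_bound δ L R₀ R hδ hL t ht h hhm (fun s => ‖F s‖) hFm.norm
      (fun s => norm_nonneg _) hhu (b ^ 3) hhb M hMpos hMl
    have hGL : ∫ l in Ioc δ L, Real.sqrt l * ‖g l‖ ^ 2 ≤ G :=
      setIntegral_mono_set hG (Eventually.of_forall fun l => by positivity)
        Ioc_subset_Ioi_self.eventuallyLE
    have i1 : IntegrableOn (fun l => Real.sqrt l * ‖g l‖ ^ 2) (Ioc δ L) :=
      hG.mono_set Ioc_subset_Ioi_self
    have i2 : IntegrableOn (fun l => (Real.sqrt l)⁻¹ * ‖H l‖ ^ 2) (Ioc δ L) := by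
      have : ContinuousOn (fun l => (Real.sqrt l)⁻¹) (Icc δ L) := by
        apply ContinuousOn.inv₀ (by fun_prop)
        intro l hl
        exact (Real.sqrt_pos.2 (hδ.trans_le hl.1)).ne'
      refine (this.integrableOn_Icc.mono_set Ioc_subset_Icc_self).mul_bdd
        (c := (∫ s in Ioo R₀ R, b ^ 3) ^ 2)
        (hHm.norm.pow_const 2).aestronglyMeasurable (Eventually.of_forall fun l => ?_)
      rw [norm_pow, norm_norm]
      exact pow_le_pow_left₀ (norm_nonneg _) (hHb l) 2
    rw [intervalIntegral.integral_of_le hL]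
    have hpt : ∀ l ∈ Ioc δ L, ‖H l * g l‖ ≤ (210 * Real.sqrt M) * (Real.sqrt l * ‖g l‖ ^ 2) +
        (840 * Real.sqrt M)⁻¹ * ((Real.sqrt l)⁻¹ * ‖H l‖ ^ 2) := by
      intro l hl
      have hl0 : 0 < Real.sqrt l := Real.sqrt_pos.2 (hδ.trans hl.1)
      rw [norm_mul]
      have : 0 ≤ (840 * Real.sqrt M * Real.sqrt l)⁻¹ *
        (420 * Real.sqrt M * Real.sqrt l * ‖g l‖ - ‖H l‖) ^ 2 := by positivity
      have e : (840 * Real.sqrt M * Real.sqrt l)⁻¹ *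
          (420 * Real.sqrt M * Real.sqrt l * ‖g l‖ - ‖H l‖) ^ 2 =
          (210 * Real.sqrt M) * (Real.sqrt l * ‖g l‖ ^ 2) +
          (840 * Real.sqrt M)⁻¹ * ((Real.sqrt l)⁻¹ * ‖H l‖ ^ 2) - ‖H l‖ * ‖g l‖ := by
        field_simp
        ring
      linarith
    calc _ ≤ ∫ l in Ioc δ L, ((210 * Real.sqrt M) * (Real.sqrt l * ‖g l‖ ^ 2) +
          (840 * Real.sqrt M)⁻¹ * ((Real.sqrt l)⁻¹ * ‖H l‖ ^ 2)) := by
          refine norm_integral_le_of_norm_le ((i1.const_mul _).add (i2.const_mul _)) ?_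
          exact (ae_restrict_mem measurableSet_Ioc).mono hpt
      _ = (210 * Real.sqrt M) * (∫ l in Ioc δ L, Real.sqrt l * ‖g l‖ ^ 2) +
          (840 * Real.sqrt M)⁻¹ * ∫ l in Ioc δ L, (Real.sqrt l)⁻¹ * ‖H l‖ ^ 2 := by
          rw [integral_add (i1.const_mul _) (i2.const_mul _), integral_const_mul,
            integral_const_mul]
      _ ≤ (210 * Real.sqrt M) * G + (840 * Real.sqrt M)⁻¹ * (420 * M * Real.sqrt M) := by
          gcongr
      _ = _ := by field_simp; ring
  have hlim := intervalIntegral_tendsto_integral_Ioi δ hHg tendsto_id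
  have hfin : ‖∫ l in Ioi δ, H l * g l‖ ≤ 210 * Real.sqrt M * G + M / 2 :=
    le_of_tendsto hlim.norm ((eventually_ge_atTop δ).mono hLb)
  rw [← hMc, Complex.norm_real, Real.norm_eq_abs, abs_of_pos hMpos] at hfin
  have : Real.sqrt M ≤ 420 * G := by
    by_contra hcon
    push Not at hcon
    nlinarith
  change M ≤ _
  nlinarith

lemma gamma_le_shift (a b : ℝ) (ha : 0 < a) (hb : 0 < b) :
    ∃ C : ℝ, 0 < C ∧ ∀ l : ℝ, ‖Complex.Gamma (a + Complex.I * l)‖ ≤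
      C * ‖Complex.Gamma ((a + b : ℝ) + Complex.I * l)‖ := by
  have hGb : 0 < ‖Complex.Gamma (b : ℂ)‖ :=
    norm_pos_iff.2 (Complex.Gamma_ne_zero_of_re_pos (by simpa using hb))
  set D := ∫ x in (0:ℝ)..1, ‖(x : ℂ) ^ ((a : ℂ) - 1) * (1 - (x : ℂ)) ^ ((b : ℂ) - 1)‖ with hD
  have hD0 : 0 ≤ D := intervalIntegral.integral_nonneg zero_le_one fun x _ => norm_nonneg _
  refine ⟨(D + 1) / ‖Complex.Gamma (b : ℂ)‖, by positivity, fun l => ?_⟩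
  have hs : 0 < ((a : ℂ) + Complex.I * l).re := by simpa using ha
  have h := Complex.Gamma_mul_Gamma_eq_betaIntegral hs (t := (b : ℂ)) (by simpa using hb)
  have hβ : ‖Complex.betaIntegral ((a : ℂ) + Complex.I * l) b‖ ≤ D := by
    rw [Complex.betaIntegral]
    refine (intervalIntegral.norm_integral_le_integral_norm zero_le_one).trans (le_of_eq ?_)
    rw [hD, intervalIntegral.integral_of_le zero_le_one, intervalIntegral.integral_of_le zero_le_one]
    refine setIntegral_congr_fun measurableSet_Ioc fun x hx => ?_
    simp only [norm_mul]
    rw [Complex.norm_cpow_eq_rpow_re_of_pos hx.1, Complex.norm_cpow_eq_rpow_re_of_pos hx.1]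
    simp
  have h2 := congrArg norm h
  rw [norm_mul, norm_mul] at h2
  have e : (a : ℂ) + Complex.I * l + b = ((a + b : ℝ) : ℂ) + Complex.I * l := by
    push_cast; ring
  rw [e] at h2
  rw [div_mul_eq_mul_div, le_div_iff₀ hGb, h2, mul_comm]
  gcongr
  linarith

lemma gamma_add_nat (z : ℂ) (hz : z.im ≠ 0) (k : ℕ) :
    ‖Complex.Gamma (z + k)‖ ≤ ‖Complex.Gamma z‖ * (‖z‖ + k) ^ k := by
  induction k with
  | zero => simp
  | succ k ih =>
    have hne : z + k ≠ 0 := by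
      intro h
      have := congrArg Complex.im h
      simp at this
      exact hz this
    have e : z + ((k + 1 : ℕ) : ℂ) = (z + k) + 1 := by push_cast; ring
    rw [e, Complex.Gamma_add_one _ hne, norm_mul]
    have h1 : ‖z + (k : ℂ)‖ ≤ ‖z‖ + ((k + 1 : ℕ) : ℝ) := by
      refine (norm_add_le _ _).trans ?_
      rw [Complex.norm_natCast]; push_cast; linarith
    have h2 : (‖z‖ + k) ^ k ≤ (‖z‖ + ((k + 1 : ℕ) : ℝ)) ^ k := by
      gcongr; simp
    calc _ ≤ (‖z‖ + ((k + 1 : ℕ) : ℝ)) *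
          (‖Complex.Gamma z‖ * (‖z‖ + ((k + 1 : ℕ) : ℝ)) ^ k) := by
          gcongr
          exact ih.trans (mul_le_mul_of_nonneg_left h2 (norm_nonneg _))
      _ = _ := by ring

lemma rhoDR_pos (mv mz : ℕ) (hmv : 0 < mv) : 0 < rhoDR mv mz := by
  unfold rhoDR
  have : (0 : ℝ) < mv := by exact_mod_cast hmv
  positivity

lemma cHC_inv_bound (mv mz : ℕ) (hmv : 0 < mv) (hmz : 0 < mz) :
    ∃ C : ℝ, 0 < C ∧ ∀ l : ℝ, 0 < l →
      ‖cHC mv mz l‖⁻¹ ≤ C * (l + (mv + mz + 1)) ^ (mv + mz + mv) := by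
  have hρ := rhoDR_pos mv mz hmv
  have hv : (0 : ℝ) < mv := by exact_mod_cast hmv
  have hz : (0 : ℝ) < mz := by exact_mod_cast hmz
  obtain ⟨C1, hC1, h1⟩ := gamma_le_shift (rhoDR mv mz) ((mv + mz : ℕ) - rhoDR mv mz) hρ
    (by unfold rhoDR; push_cast; linarith)
  obtain ⟨C2, hC2, h2⟩ := gamma_le_shift ((mv : ℝ) / 4 + 1 / 2) ((mv : ℝ) * 3 / 4) (by positivity)
    (by positivity)
  set n0 := ‖Complex.Gamma (((mv : ℂ) + mz + 1) / 2)‖ with hn0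
  have hn0p : 0 < n0 := by
    apply norm_pos_iff.2 (Complex.Gamma_ne_zero_of_re_pos _)
    have : ((mv : ℂ) + mz + 1) / 2 = (((mv + mz + 1 : ℝ) / 2 : ℝ) : ℂ) := by push_cast; ring
    rw [this, Complex.ofReal_re]
    positivity
  set p0 := (4 : ℝ) ^ (rhoDR mv mz) with hp0
  have hp0p : 0 < p0 := by positivity
  refine ⟨C1 * C2 * (2 * Real.sqrt Real.pi) / (p0 * n0), by positivity, fun l hl => ?_⟩
  -- norms of the constituents
  have a1 : ‖(4 : ℂ) ^ ((rhoDR mv mz : ℂ) - Complex.I * l)‖ = p0 := by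
    have := Complex.norm_cpow_eq_rpow_re_of_pos (show (0:ℝ) < 4 by norm_num)
      ((rhoDR mv mz : ℂ) - Complex.I * l)
    simpa using this
  set Q := (l + (mv + mz + 1) : ℝ) with hQ
  have g1 : ‖Complex.Gamma ((rhoDR mv mz : ℂ) + Complex.I * l)‖ ≤
      C1 * (‖Complex.Gamma (Complex.I * l)‖ * Q ^ (mv + mz)) := by
    refine (h1 l).trans ?_
    have := gamma_add_nat (Complex.I * l) (by simpa using hl.ne') (mv + mz)
    have e : ((rhoDR mv mz + ((mv + mz : ℕ) - rhoDR mv mz) : ℝ) : ℂ) + Complex.I * l =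
        Complex.I * l + ((mv + mz : ℕ) : ℂ) := by push_cast; ring
    rw [e]
    gcongr
    refine this.trans ?_
    have hn : ‖Complex.I * (l : ℂ)‖ = l := by simp [abs_of_pos hl]
    rw [hn]
    gcongr
    rw [hQ]; push_cast; linarith
  have g2 : ‖Complex.Gamma (((mv : ℂ) + 4 * Complex.I * l + 2) / 4)‖ ≤
      C2 * (‖Complex.Gamma (Complex.I * l + 1 / 2)‖ * Q ^ mv) := by
    have e0 : ((mv : ℂ) + 4 * Complex.I * l + 2) / 4 =
        (((mv : ℝ) / 4 + 1 / 2 : ℝ) : ℂ) + Complex.I * l := by push_cast; ring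
    rw [e0]
    refine (h2 l).trans ?_
    have := gamma_add_nat (Complex.I * l + 1 / 2) (by simpa using hl.ne') mv
    have e : (((mv : ℝ) / 4 + 1 / 2 + (mv : ℝ) * 3 / 4 : ℝ) : ℂ) + Complex.I * l =
        Complex.I * l + 1 / 2 + (mv : ℂ) := by push_cast; ring
    rw [e]
    gcongr
    refine this.trans ?_
    have hn : ‖Complex.I * (l : ℂ) + 1 / 2‖ ≤ l + 1 / 2 := by
      refine (norm_add_le _ _).trans ?_
      simp [abs_of_pos hl]
    gcongr
    rw [hQ]; linarith
  have dup : ‖Complex.Gamma (Complex.I * l)‖ * ‖Complex.Gamma (Complex.I * l + 1 / 2)‖ =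
      ‖Complex.Gamma (2 * Complex.I * l)‖ * (2 * Real.sqrt Real.pi) := by
    rw [← norm_mul, Complex.Gamma_mul_Gamma_add_half, norm_mul, norm_mul, ← mul_assoc 2]
    have := Complex.norm_cpow_eq_rpow_re_of_pos (show (0:ℝ) < 2 by norm_num)
      (1 - 2 * Complex.I * (l : ℂ))
    have e : ‖(2 : ℂ) ^ (1 - 2 * Complex.I * (l : ℂ))‖ = 2 := by simpa using this
    rw [e, Complex.norm_real, Real.norm_eq_abs, abs_of_nonneg (Real.sqrt_nonneg _)]
    ring
  have hne : 0 < ‖Complex.Gamma (2 * Complex.I * l)‖ := by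
    apply norm_pos_iff.2
    apply Complex.Gamma_ne_zero
    intro m hm
    have := congrArg Complex.im hm
    simp at this
    exact hl.ne' this
  unfold cHC
  rw [norm_mul, norm_mul, norm_div, norm_div, a1, ← hn0]
  set X := ‖Complex.Gamma (2 * Complex.I * l)‖
  set Y := ‖Complex.Gamma ((rhoDR mv mz : ℂ) + Complex.I * l)‖
  set Z := ‖Complex.Gamma (((mv : ℂ) + 4 * Complex.I * l + 2) / 4)‖
  have hYZ : Y * Z ≤ C1 * C2 * (X * (2 * Real.sqrt Real.pi)) * Q ^ (mv + mz + mv) := by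
    have hQ0 : 0 < Q := by positivity
    calc Y * Z ≤ _ := mul_le_mul g1 g2 (norm_nonneg _) (by positivity)
      _ = C1 * C2 * (‖Complex.Gamma (Complex.I * l)‖ * ‖Complex.Gamma (Complex.I * l + 1 / 2)‖)
          * Q ^ (mv + mz + mv) := by rw [pow_add Q (mv + mz)]; ring
      _ = _ := by rw [dup]
  have e : (p0 * (X / Y) * (n0 / Z))⁻¹ = (Y * Z) / (p0 * n0 * X) := by
    rw [mul_inv, mul_inv, inv_div, inv_div]
    field_simp
  rw [e, div_le_iff₀ (by positivity)]
  refine hYZ.trans (le_of_eq ?_)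
  field_simp

lemma cHC_cont (mv mz : ℕ) (hmv : 0 < mv) : ContinuousOn (cHC mv mz) (Ioi 0) := by
  have hρ := rhoDR_pos mv mz hmv
  have hv : (0 : ℝ) < mv := by exact_mod_cast hmv
  have gc : ∀ f : ℝ → ℂ, Continuous f → (∀ l : ℝ, 0 < l → 0 < (f l).im) →
      ContinuousOn (fun l => Complex.Gamma (f l)) (Ioi 0) ∧
      ∀ l ∈ Ioi (0:ℝ), Complex.Gamma (f l) ≠ 0 := by
    intro f hf him
    have hm : ∀ l : ℝ, 0 < l → ∀ m : ℕ, f l ≠ -m := by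
      intro l hl m hm
      have h1 := him l hl
      rw [hm] at h1
      simp at h1
    refine ⟨fun l hl => ?_, fun l hl => Complex.Gamma_ne_zero (hm l hl)⟩
    exact ((Complex.differentiableAt_Gamma _ (hm l hl)).continuousAt.comp
      hf.continuousAt).continuousWithinAt
  have k1 := gc (fun l => 2 * Complex.I * l) (by fun_prop) (by intro l hl; simpa using hl)
  have k2 := gc (fun l => (rhoDR mv mz : ℂ) + Complex.I * l) (by fun_prop)
    (by intro l hl; simpa using hl)
  have k3 := gc (fun l => ((mv : ℂ) + 4 * Complex.I * l + 2) / 4) (by fun_prop)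
    (by
      intro l hl
      have : ((mv : ℂ) + 4 * Complex.I * l + 2) / 4 =
        (((mv : ℝ) / 4 + 1 / 2 : ℝ) : ℂ) + Complex.I * l := by push_cast; ring
      rw [this]; simpa using hl)
  unfold cHC
  refine ContinuousOn.mul (ContinuousOn.mul ?_ (k1.1.div k2.1 k2.2))
    (continuousOn_const.div k3.1 k3.2)
  apply Continuous.continuousOn
  exact Continuous.const_cpow (by fun_prop) (Or.inl (by norm_num))

lemma schwartz_int (φ : SchwartzMap ℝ ℂ) (δ K : ℝ) (hδ : 0 < δ) (hK : 0 ≤ K) (N : ℕ) :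
    IntegrableOn (fun l => (l + K) ^ N * ‖φ l‖) (Ioi δ) := by
  have i1 := (φ.integrable_pow_mul volume N).integrableOn (s := Ioi δ)
  have i0 := (φ.integrable_pow_mul volume 0).integrableOn (s := Ioi δ)
  have i2 := (i1.add (i0.const_mul (K ^ N))).const_mul (2 ^ (N - 1))
  refine Integrable.mono' i2 (by fun_prop) ?_
  refine (ae_restrict_mem measurableSet_Ioi).mono fun l hl => ?_
  have hl0 : 0 < l := hδ.trans hl
  have h := add_pow_le hl0.le hK N
  rw [Real.norm_eq_abs, abs_of_nonneg (by positivity)]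
  simp only [Pi.add_apply, Real.norm_eq_abs, abs_of_pos hl0, pow_zero, one_mul]
  calc _ ≤ 2 ^ (N - 1) * (l ^ N + K ^ N) * ‖φ l‖ := by gcongr
    _ = _ := by ring

lemma Adens_inv_le (mv mz : ℕ) (s : ℝ) (hs : 3 < s) :
    0 ≤ (Adens mv mz s)⁻¹ ∧ (Adens mv mz s)⁻¹ ≤ 1 := by
  have h1 : 1 ≤ Real.sinh (s / 2) := by
    have := Real.self_le_sinh_iff.2 (show 0 ≤ s / 2 by linarith)
    linarith
  have h2 := Real.one_le_cosh (s / 2)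
  have : 1 ≤ Adens mv mz s := by
    unfold Adens
    have a1 : (1 : ℝ) ≤ 2 ^ (mv + mz) := one_le_pow₀ (by norm_num)
    have a2 := one_le_pow₀ h1 (n := mv + mz)
    have a3 := one_le_pow₀ h2 (n := mz)
    exact one_le_mul_of_one_le_of_one_le (one_le_mul_of_one_le_of_one_le a1 a2) a3
  exact ⟨by positivity, inv_le_one_of_one_le₀ this⟩

/-- The `L⁴` annulus estimate of Lemma 4.7(a) for the leading term `T₃` of the
linearized Schrödinger maximal operator: there is `R₀ > 2` such that for every
`R > R₀` there is `C > 0` (independent of the measurable time function `t`)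
such that for every even Schwartz `φ` vanishing on `(-1/R₀, 1/R₀)`,
`(∫_{R₀}^R A(s)^{-1} |∫_{1/R₀}^∞ c(λ) e^{i(λs+t(s)(λ²+ρ²))} φ(λ) |c(λ)|⁻² dλ|⁴ ds)^{1/4}
  ≤ C (∫_{1/R₀}^∞ (λ²+ρ²)^{1/4} |φ(λ)|² |c(λ)|⁻² dλ)^{1/2}`. -/
theorem annulus_L4_estimate (mv mz : ℕ) (hmv : 0 < mv) (hmz : 0 < mz) :
    ∃ R₀ : ℝ, 2 < R₀ ∧ ∀ R : ℝ, R₀ < R → ∃ C : ℝ, 0 < C ∧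
      ∀ t : ℝ → ℝ, Measurable t →
        (∀ s ∈ Set.Ioo R₀ R, t s ∈ Set.Ioo 0 (1 / rhoDR mv mz ^ 2)) →
      ∀ φ : SchwartzMap ℝ ℂ, (∀ x, φ (-x) = φ x) →
        (∀ x : ℝ, |x| < 1 / R₀ → φ x = 0) →
      (∫ s in Set.Ioo R₀ R, (Adens mv mz s)⁻¹ *
          ‖∫ l in Set.Ioi (1 / R₀),
            cHC mv mz l
              * Complex.exp (Complex.I *
                  ((l * s + t s * (l ^ 2 + rhoDR mv mz ^ 2) : ℝ) : ℂ))
              * φ l * (((‖cHC mv mz l‖ ^ 2)⁻¹ : ℝ) : ℂ)‖ ^ 4) ^ ((1 : ℝ) / 4)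
        ≤ C * (∫ l in Set.Ioi (1 / R₀),
            (l ^ 2 + rhoDR mv mz ^ 2) ^ ((1 : ℝ) / 4) * ‖φ l‖ ^ 2
              * (‖cHC mv mz l‖ ^ 2)⁻¹) ^ ((1 : ℝ) / 2) := by
  refine ⟨3, by norm_num, fun R hR => ⟨21, by norm_num, fun t ht _ φ _ _ => ?_⟩⟩
  set δ : ℝ := 1 / 3 with hδdef
  have hδ : 0 < δ := by norm_num
  set ρ := rhoDR mv mz with hρdef
  have hρ : 0 < ρ := rhoDR_pos mv mz hmv
  obtain ⟨C, hC, hCb⟩ := cHC_inv_bound mv mz hmv hmz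
  set g0 : ℝ → ℂ := fun l => cHC mv mz l * φ l * (((‖cHC mv mz l‖ ^ 2)⁻¹ : ℝ) : ℂ) with hg0
  have hcm : AEStronglyMeasurable (cHC mv mz) (volume.restrict (Ioi δ)) :=
    ((cHC_cont mv mz hmv).mono (Ioi_subset_Ioi hδ.le)).aestronglyMeasurable measurableSet_Ioi
  have hφm : AEStronglyMeasurable (fun l => φ l) (volume.restrict (Ioi δ)) :=
    φ.continuous.aestronglyMeasurable
  have hinvm : AEStronglyMeasurable (fun l => (‖cHC mv mz l‖ ^ 2)⁻¹) (volume.restrict (Ioi δ)) :=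
    (hcm.norm.aemeasurable.pow_const 2).inv.aestronglyMeasurable
  have hgm0 : AEStronglyMeasurable g0 (volume.restrict (Ioi δ)) :=
    (hcm.mul hφm).mul (Complex.continuous_ofReal.comp_aestronglyMeasurable hinvm)
  have hgn : ∀ l, ‖g0 l‖ = ‖cHC mv mz l‖⁻¹ * ‖φ l‖ := by
    intro l
    rw [hg0, norm_mul, norm_mul, Complex.norm_real, norm_inv, norm_pow, norm_norm]
    by_cases h : ‖cHC mv mz l‖ = 0
    · rw [h]; simp
    · field_simp
  have hgn2 : ∀ l, ‖g0 l‖ ^ 2 = ‖φ l‖ ^ 2 * (‖cHC mv mz l‖ ^ 2)⁻¹ := by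
    intro l
    rw [hgn, mul_pow, inv_pow, mul_comm]
  set K : ℝ := mv + mz + 1 with hK
  have hK0 : 0 < K := by positivity
  set N := mv + mz + mv with hN
  have hgi0 : IntegrableOn g0 (Ioi δ) := by
    refine Integrable.mono' ((schwartz_int φ δ K hδ hK0.le N).const_mul C) hgm0 ?_
    refine (ae_restrict_mem measurableSet_Ioi).mono fun l hl => ?_
    rw [hgn, ← mul_assoc]
    gcongr
    exact hCb l (hδ.trans hl)
  obtain ⟨D, hD0, hD⟩ : ∃ D : ℝ, 0 ≤ D ∧ ∀ l, ‖φ l‖ ≤ D := by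
    obtain ⟨D, hD⟩ := φ.decay 0 0
    refine ⟨D, hD.1.le, fun l => by simpa using hD.2 l⟩
  have hρK : 1 + ρ ≤ K := by
    rw [hρdef, hK]; unfold rhoDR
    have : (0 : ℝ) ≤ mv := by positivity
    have : (0 : ℝ) ≤ mz := by positivity
    linarith
  have hRi : IntegrableOn (fun l => (l ^ 2 + ρ ^ 2) ^ ((1 : ℝ) / 4) * ‖φ l‖ ^ 2
      * (‖cHC mv mz l‖ ^ 2)⁻¹) (Ioi δ) := by
    refine Integrable.mono' ((schwartz_int φ δ K hδ hK0.le (2 + 2 * N)).const_mul (C ^ 2 * D))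
      (AEStronglyMeasurable.mul (AEStronglyMeasurable.mul ?_ (hφm.norm.pow 2)) hinvm) ?_
    · apply Continuous.aestronglyMeasurable
      exact Continuous.rpow_const (by fun_prop) (fun l => Or.inr (by norm_num))
    refine (ae_restrict_mem measurableSet_Ioi).mono fun l hl => ?_
    have hl0 : 0 < l := hδ.trans hl
    rw [Real.norm_eq_abs, abs_of_nonneg (by positivity), mul_assoc, ← hgn2]
    have b1 : (l ^ 2 + ρ ^ 2) ^ ((1 : ℝ) / 4) ≤ (l + K) ^ 2 := by
      calc (l ^ 2 + ρ ^ 2) ^ ((1 : ℝ) / 4) ≤ (1 + (l ^ 2 + ρ ^ 2)) ^ ((1 : ℝ) / 4) := by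
            apply Real.rpow_le_rpow (by positivity) (by linarith) (by norm_num)
        _ ≤ (1 + (l ^ 2 + ρ ^ 2)) ^ (1 : ℝ) := by
            apply Real.rpow_le_rpow_of_exponent_le
            · nlinarith
            · norm_num
        _ ≤ _ := by rw [Real.rpow_one]; nlinarith
    have b2 : ‖g0 l‖ ^ 2 ≤ (C * (l + K) ^ N) ^ 2 * (D * ‖φ l‖) := by
      rw [hgn, mul_pow]
      gcongr
      · exact hCb l hl0
      · rw [sq]; gcongr; exact hD l
    calc _ ≤ (l + K) ^ 2 * ((C * (l + K) ^ N) ^ 2 * (D * ‖φ l‖)) := by gcongr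
      _ = _ := by rw [pow_add (l + K) 2 (2 * N), mul_comm 2 N, pow_mul (l + K) N 2]; ring
  have hsq : ∀ l ∈ Ioi δ, Real.sqrt l * ‖g0 l‖ ^ 2 ≤ (l ^ 2 + ρ ^ 2) ^ ((1 : ℝ) / 4) * ‖φ l‖ ^ 2
      * (‖cHC mv mz l‖ ^ 2)⁻¹ := by
    intro l hl
    have hl0 : 0 < l := hδ.trans hl
    rw [hgn2, ← mul_assoc]
    gcongr
    have : Real.sqrt l = (l ^ 2) ^ ((1 : ℝ) / 4) := by
      rw [Real.sqrt_eq_rpow, ← Real.rpow_natCast l 2, ← Real.rpow_mul hl0.le]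
      norm_num
    rw [this]
    gcongr
    nlinarith
  have hGi0 : IntegrableOn (fun l => Real.sqrt l * ‖g0 l‖ ^ 2) (Ioi δ) := by
    refine Integrable.mono' hRi
      (Real.continuous_sqrt.aestronglyMeasurable.mul (hgm0.norm.pow 2)) ?_
    refine (ae_restrict_mem measurableSet_Ioi).mono fun l hl => ?_
    rw [Real.norm_eq_abs, abs_of_nonneg (by positivity)]
    exact hsq l hl
  -- pass to a measurable representative
  set g := hgm0.mk g0 with hg
  have hgg : g0 =ᵐ[volume.restrict (Ioi δ)] g := hgm0.ae_eq_mk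
  have hGeq : (fun l => Real.sqrt l * ‖g0 l‖ ^ 2) =ᵐ[volume.restrict (Ioi δ)]
      fun l => Real.sqrt l * ‖g l‖ ^ 2 := hgg.mono fun l hl => by simp only [hl]
  obtain ⟨hi, hb⟩ := abstract_L4 δ 3 R hδ t ht g hgm0.stronglyMeasurable_mk.measurable
    (hgi0.congr hgg) (hGi0.congr hGeq)
  rw [← integral_congr_ae hGeq] at hb
  have hin : ∀ s, ‖∫ l in Ioi δ, cHC mv mz l
      * Complex.exp (Complex.I * ((l * s + t s * (l ^ 2 + ρ ^ 2) : ℝ) : ℂ))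
      * φ l * (((‖cHC mv mz l‖ ^ 2)⁻¹ : ℝ) : ℂ)‖ = ‖∫ l in Ioi δ, Eph t s l * g l‖ := by
    intro s
    have e : ∫ l in Ioi δ, cHC mv mz l
        * Complex.exp (Complex.I * ((l * s + t s * (l ^ 2 + ρ ^ 2) : ℝ) : ℂ))
        * φ l * (((‖cHC mv mz l‖ ^ 2)⁻¹ : ℝ) : ℂ) =
        Complex.exp (((t s * ρ ^ 2 : ℝ) : ℂ) * Complex.I) * ∫ l in Ioi δ, Eph t s l * g l := by
      rw [← integral_const_mul]
      refine integral_congr_ae (hgg.mono fun l hl => ?_)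
      simp only
      rw [← hl, ← mul_assoc, Eph, ← Complex.exp_add]
      have : Complex.I * ((l * s + t s * (l ^ 2 + ρ ^ 2) : ℝ) : ℂ) =
          ((t s * ρ ^ 2 : ℝ) : ℂ) * Complex.I + Complex.I * ((l * s + t s * l ^ 2 : ℝ) : ℂ) := by
        push_cast; ring
      rw [this]
      simp only [hg0]
      ring
    rw [e, norm_mul, Complex.norm_exp_ofReal_mul_I, one_mul]
  simp_rw [hin]
  set G := ∫ l in Ioi δ, Real.sqrt l * ‖g0 l‖ ^ 2 with hG
  have hG0 : 0 ≤ G := integral_nonneg fun l => by positivity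
  have hGle : G ≤ ∫ l in Ioi δ, (l ^ 2 + ρ ^ 2) ^ ((1 : ℝ) / 4) * ‖φ l‖ ^ 2
      * (‖cHC mv mz l‖ ^ 2)⁻¹ := setIntegral_mono_on hGi0 hRi measurableSet_Ioi hsq
  have hlhs : ∫ s in Ioo 3 R, (Adens mv mz s)⁻¹ * ‖∫ l in Ioi δ, Eph t s l * g l‖ ^ 4 ≤
      (420 * G) ^ 2 := by
    refine le_trans (integral_mono_of_nonneg ?_ hi ?_) hb
    · refine (ae_restrict_mem measurableSet_Ioo).mono fun s hs => ?_
      exact mul_nonneg (Adens_inv_le mv mz s hs.1).1 (by positivity)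
    · refine (ae_restrict_mem measurableSet_Ioo).mono fun s hs => ?_
      exact mul_le_of_le_one_left (by positivity) (Adens_inv_le mv mz s hs.1).2
  have hlhs0 : 0 ≤ ∫ s in Ioo 3 R, (Adens mv mz s)⁻¹ * ‖∫ l in Ioi δ, Eph t s l * g l‖ ^ 4 :=
    setIntegral_nonneg measurableSet_Ioo fun s hs =>
      mul_nonneg (Adens_inv_le mv mz s hs.1).1 (by positivity)
  calc _ ≤ ((420 * G) ^ 2) ^ ((1 : ℝ) / 4) := by gcongr
    _ = (420 * G) ^ ((1 : ℝ) / 2) := by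
        rw [← Real.rpow_natCast, ← Real.rpow_mul (by positivity)]
        norm_num
    _ ≤ 21 * G ^ ((1 : ℝ) / 2) := by
        rw [Real.mul_rpow (by norm_num) hG0]
        gcongr
        rw [← Real.sqrt_eq_rpow, Real.sqrt_le_left (by norm_num)]
        norm_num
    _ ≤ _ := by gcongr
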